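/- Let L, H > 0 and k₀, ū ≥ 0. Let k : [0,L] × [0,H] → ℝ be C¹ with 0 ≤ k ≤ k₀ and ∂_z k ≥ 0 everywhere, and let u : [0,L] × [0,H] → ℝ be C¹ with |u| ≤ ū. Then |∫_{(0,L)×(0,H)} k ∂_z u| ≤ 3 k₀ ū L. -/

import Mathlib

open MeasureTheory Set Filter

/-- Partial derivative in the first (horizontal, `y`) variable. -/
noncomputable def pdy (f : ℝ × ℝ → ℝ) (x : ℝ × ℝ) : ℝ := deriv (fun t => f (t, x.2)) x.1

/-- Partial derivative in the second (vertical, `z`) variable. -/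
noncomputable def pdz (f : ℝ × ℝ → ℝ) (x : ℝ × ℝ) : ℝ := deriv (fun t => f (x.1, t)) x.2

theorem hasDerivAt_pdz {f : ℝ × ℝ → ℝ} {x : ℝ × ℝ} (hf : DifferentiableAt ℝ f x) :
    HasDerivAt (fun t => f (x.1, t)) (pdz f x) x.2 := by
  have h := (show HasFDerivAt f (fderiv ℝ f x) (x.1, x.2) from hf.hasFDerivAt).comp_hasDerivAt x.2
    ((hasDerivAt_const x.2 x.1).prodMk (hasDerivAt_id x.2))
  exact h.differentiableAt.hasDerivAt

theorem pdz_eq_fderiv {f : ℝ × ℝ → ℝ} {x : ℝ × ℝ} (hf : DifferentiableAt ℝ f x) :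
    pdz f x = fderiv ℝ f x (0, 1) := by
  have h := (show HasFDerivAt f (fderiv ℝ f x) (x.1, x.2) from hf.hasFDerivAt).comp_hasDerivAt x.2
    ((hasDerivAt_const x.2 x.1).prodMk (hasDerivAt_id x.2))
  exact h.deriv

theorem ContDiffOn.continuousOn_pdz {f : ℝ × ℝ → ℝ} {U : Set (ℝ × ℝ)} (hU : IsOpen U)
    (hf : ContDiffOn ℝ 1 f U) : ContinuousOn (pdz f) U :=
  ((hf.continuousOn_fderiv_of_isOpen hU le_rfl).clm_apply continuousOn_const).congr fun _ hx =>
    pdz_eq_fderiv ((hf.differentiableOn one_ne_zero).differentiableAt (hU.mem_nhds hx))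

/-- If `k` is nondecreasing with values in `[0, C]` and `|u| ≤ M`, then `|∫ k u'| ≤ 3 C M`. -/
theorem abs_integral_mul_deriv_le {a b C M : ℝ} (hab : a ≤ b) {k k' u u' : ℝ → ℝ}
    (hk : ∀ t ∈ Icc a b, HasDerivAt k (k' t) t) (hu : ∀ t ∈ Icc a b, HasDerivAt u (u' t) t)
    (hk' : ContinuousOn k' (Icc a b)) (hu' : ContinuousOn u' (Icc a b))
    (hkC : ∀ t ∈ Icc a b, k t ∈ Icc 0 C) (hk'0 : ∀ t ∈ Icc a b, 0 ≤ k' t)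
    (huM : ∀ t ∈ Icc a b, |u t| ≤ M) :
    |∫ t in a..b, k t * u' t| ≤ 3 * C * M := by
  have ha : a ∈ Icc a b := left_mem_Icc.2 hab
  have hb : b ∈ Icc a b := right_mem_Icc.2 hab
  have hM : 0 ≤ M := (abs_nonneg _).trans (huM a ha)
  have hk'i : IntervalIntegrable k' volume a b := hk'.intervalIntegrable_of_Icc hab
  have hu'i : IntervalIntegrable u' volume a b := hu'.intervalIntegrable_of_Icc hab
  rw [← uIcc_of_le hab] at hk hu
  rw [intervalIntegral.integral_mul_deriv_eq_deriv_mul hk hu hk'i hu'i]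
  have hint : |∫ t in a..b, k' t * u t| ≤ (k b - k a) * M := by
    rw [← intervalIntegral.integral_eq_sub_of_hasDerivAt hk hk'i,
      ← intervalIntegral.integral_mul_const, ← Real.norm_eq_abs]
    refine intervalIntegral.norm_integral_le_of_norm_le hab
      (Eventually.of_forall fun t ht => ?_) (hk'i.mul_const M)
    have ht' := Ioc_subset_Icc_self ht
    rw [Real.norm_eq_abs, abs_mul, abs_of_nonneg (hk'0 t ht')]
    exact mul_le_mul_of_nonneg_left (huM t ht') (hk'0 t ht')
  have hbd : ∀ t ∈ Icc a b, |k t * u t| ≤ C * M := fun t ht => by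
    rw [abs_mul, abs_of_nonneg (hkC t ht).1]
    exact mul_le_mul (hkC t ht).2 (huM t ht) (abs_nonneg _) ((hkC t ht).1.trans (hkC t ht).2)
  have hsub : (k b - k a) * M ≤ C * M :=
    mul_le_mul_of_nonneg_right (by linarith [(hkC b hb).2, (hkC a ha).1]) hM
  have h1 := abs_le.1 (hbd a ha)
  have h2 := abs_le.1 (hbd b hb)
  have h3 := abs_le.1 (hint.trans hsub)
  exact abs_le.2 ⟨by linarith [h1.2, h2.1, h3.2], by linarith [h1.1, h2.2, h3.1]⟩

/-- Averaging bound: `|∫ k ∂_z u| ≤ 3 k₀ ū L` on the rectangle `(0,L) × (0,H)`. -/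
theorem weighted_vertical_derivative_bound
    (L H k₀ uBar : ℝ) (hL : 0 < L) (hH : 0 < H)
    (hk₀ : 0 ≤ k₀) (huBar : 0 ≤ uBar)
    (k u : ℝ × ℝ → ℝ) (U : Set (ℝ × ℝ)) (hU : IsOpen U)
    (hUsub : Icc (0:ℝ) L ×ˢ Icc (0:ℝ) H ⊆ U)
    (hkC1 : ContDiffOn ℝ 1 k U) (huC1 : ContDiffOn ℝ 1 u U)
    (hkbound : ∀ x ∈ Icc (0:ℝ) L ×ˢ Icc (0:ℝ) H, k x ∈ Icc (0:ℝ) k₀)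
    (hkmono : ∀ x ∈ Icc (0:ℝ) L ×ˢ Icc (0:ℝ) H, 0 ≤ pdz k x)
    (hubound : ∀ x ∈ Icc (0:ℝ) L ×ˢ Icc (0:ℝ) H, |u x| ≤ uBar) :
    |∫ x in Ioo (0:ℝ) L ×ˢ Ioo (0:ℝ) H, k x * pdz u x| ≤ 3 * k₀ * uBar * L := by
  have hdiff : ∀ {f : ℝ × ℝ → ℝ}, ContDiffOn ℝ 1 f U →
      ∀ x ∈ Icc (0:ℝ) L ×ˢ Icc (0:ℝ) H, HasDerivAt (fun t => f (x.1, t)) (pdz f x) x.2 :=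
    fun hf x hx => hasDerivAt_pdz
      ((hf.differentiableOn one_ne_zero).differentiableAt (hU.mem_nhds (hUsub hx)))
  have hslice : ∀ {f : ℝ × ℝ → ℝ}, ContDiffOn ℝ 1 f U →
      ∀ y ∈ Icc (0:ℝ) L, ContinuousOn (fun t => pdz f (y, t)) (Icc 0 H) := fun hf y hy =>
    (hf.continuousOn_pdz hU).comp (f := fun t => (y, t)) (by fun_prop)
      fun _ ht => hUsub (mk_mem_prod hy ht)
  have hint : IntegrableOn (fun x => k x * pdz u x) (Ioo (0:ℝ) L ×ˢ Ioo (0:ℝ) H)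
      (volume.prod volume) :=
    (((hkC1.continuousOn.mul (huC1.continuousOn_pdz hU)).mono hUsub).integrableOn_compact
      (isCompact_Icc.prod isCompact_Icc)).mono_set
      (prod_mono Ioo_subset_Icc_self Ioo_subset_Icc_self)
  rw [Measure.volume_eq_prod, setIntegral_prod _ hint, ← Real.norm_eq_abs]
  have hbd : ∀ y ∈ Ioo (0:ℝ) L,
      ‖∫ z in Ioo (0:ℝ) H, k (y, z) * pdz u (y, z)‖ ≤ 3 * k₀ * uBar := fun y hy => by
    have hy' := Ioo_subset_Icc_self hy
    rw [← integral_Ioc_eq_integral_Ioo, ← intervalIntegral.integral_of_le hH.le, Real.norm_eq_abs]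
    exact abs_integral_mul_deriv_le hH.le (fun t ht => hdiff hkC1 (y, t) ⟨hy', ht⟩)
      (fun t ht => hdiff huC1 (y, t) ⟨hy', ht⟩) (hslice hkC1 y hy') (hslice huC1 y hy')
      (fun t ht => hkbound (y, t) ⟨hy', ht⟩) (fun t ht => hkmono (y, t) ⟨hy', ht⟩)
      (fun t ht => hubound (y, t) ⟨hy', ht⟩)
  simpa [Measure.real, hL.le] using
    norm_setIntegral_le_of_norm_le_const (μ := volume) measure_Ioo_lt_top hbd
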